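/- There exists c > 0 such that for every integer r ≥ 0 and every φ ∈ 𝒪¹(ℂ̄∖[0,1]), sup_{z∈D∞} |(T^r φ)(z)| ≤ c·((√5 − 1)/2)^r · sup_{z∈D∞} |φ(z)|. -/

import Mathlib

open Complex Filter Set Topology
open scoped ENNReal NNReal

noncomputable section

/-- The complement in `ℂ` of the real segment `[a, b]`. -/
def cutPlane (a b : ℝ) : Set ℂ := (Complex.ofReal '' Set.Icc a b)ᶜ

/-- `𝒪¹(ℂ̄ ∖ [a,b])`: holomorphic on `ℂ ∖ [a,b]`, vanishing at infinity. -/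
def O1 (a b : ℝ) : Set (ℂ → ℂ) :=
  {φ | DifferentiableOn ℂ φ (cutPlane a b) ∧
       Tendsto φ (Bornology.cobounded ℂ) (nhds 0)}

/-- `𝒪³(ℂ̄ ∖ [a,b])`: holomorphic on `ℂ ∖ [a,b]`, with `z²ψ(z) → 0` at infinity. -/
def O3 (a b : ℝ) : Set (ℂ → ℂ) :=
  {ψ | DifferentiableOn ℂ ψ (cutPlane a b) ∧
       Tendsto (fun z => z ^ 2 * ψ z) (Bornology.cobounded ℂ) (nhds 0)}

/-- The `m`-th term (for the integer `m+1 ≥ 1`) of the series defining `T`. -/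
def Tterm (φ : ℂ → ℂ) (m : ℕ) (z : ℂ) : ℂ :=
  -z * (φ (z⁻¹ - ((m : ℂ) + 1)) - φ (-((m : ℂ) + 1))) + deriv φ (-((m : ℂ) + 1))

/-- The operator `T`. -/
def Tbrj (φ : ℂ → ℂ) : ℂ → ℂ := fun z => ∑' m : ℕ, Tterm φ m z

/-- The operator `T⁽³⁾`. -/
def T3brj (ψ : ℂ → ℂ) : ℂ → ℂ := fun z => -∑' m : ℕ, (z⁻¹) ^ 3 * ψ (z⁻¹ - ((m : ℂ) + 1))

/-- `g(m) = (0 1; 1 m)`. -/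
def gmat (m : ℤ) : Matrix (Fin 2) (Fin 2) ℤ := !![0, 1; 1, m]

/-- The monoid `ℳ`. -/
def Mmon : Set (Matrix (Fin 2) (Fin 2) ℤ) :=
  {g | g = 1 ∨
    ((g 0 0 * g 1 1 - g 0 1 * g 1 0 = 1 ∨ g 0 0 * g 1 1 - g 0 1 * g 1 0 = -1) ∧
      g 0 1 ≤ g 1 1 ∧ g 0 0 ≤ g 0 1 ∧ 0 ≤ g 0 0 ∧ g 1 0 ≤ g 1 1 ∧ g 0 0 ≤ g 1 0)}

/-- The operator `L_g` on `𝒪¹(ℂ̄ ∖ [0,1])`, for `g = (a b; c d) ∈ ℳ`. -/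
def Lop (g : Matrix (Fin 2) (Fin 2) ℤ) (φ : ℂ → ℂ) : ℂ → ℂ := fun z =>
  if g = 1 then φ z
  else
    ((g 0 0 : ℂ) - (g 1 0 : ℂ) * z) *
        (φ (((g 1 1 : ℂ) * z - (g 0 1 : ℂ)) / ((g 0 0 : ℂ) - (g 1 0 : ℂ) * z)) -
          φ (-(g 1 1 : ℂ) / (g 1 0 : ℂ))) -
      ((g 0 0 * g 1 1 - g 0 1 * g 1 0 : ℤ) : ℂ) * ((g 1 0 : ℂ))⁻¹ *
        deriv φ (-(g 1 1 : ℂ) / (g 1 0 : ℂ))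

/-- `Σ_ℳ φ`, the sum of the family `(L_g φ)_{g ∈ ℳ}`. -/
def sumM (φ : ℂ → ℂ) : ℂ → ℂ := fun z => ∑' g : Mmon, Lop g.1 φ z

/-- The domain `D`. -/
def Dset : Set ℂ :=
  {z | ‖z‖ ≤ 1 ∧ 1 ≤ ‖z - Complex.I‖ ∧ 1 ≤ ‖z + Complex.I‖ ∧ 0 < z.re}

/-- The domain `D₀`. -/
def D0set : Set ℂ := {z | ‖z + 1‖ ≤ 1 ∧ Real.sqrt 3 / 2 - 1 ≤ z.re}

/-- The domain `D₁`. -/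
def D1set : Set ℂ :=
  {z | 1 ≤ ‖z‖ ∧ ‖z - (1 / Real.sqrt 3 : ℝ)‖ ≤ 1 / Real.sqrt 3}

/-- The domain `H₀`. -/
def H0set : Set ℂ := {z | ‖z - Complex.I‖ ≤ 1 ∧ 1 ≤ ‖z + 1‖ ∧ z.im ≤ 1 / 2}

/-- The domain `H₀′`. -/
def H0set' : Set ℂ := {z | (starRingEnd ℂ) z ∈ H0set}

/-- The domain `Δ`. -/
def Δset : Set ℂ := {z | ‖z‖ ≤ 1 ∧ 1 ≤ ‖z + 1‖ ∧ |z.im| ≤ 1 / 2}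

/-- The domain `D∞`. -/
def Dinf : Set ℂ :=
  {z | 1 / 2 < |z.im|} ∪ {z | z.re < Real.sqrt 3 / 2 - 1} ∪
    {z | Real.sqrt 3 / 2 < z.re ∧ 1 / Real.sqrt 3 < ‖z - (1 / Real.sqrt 3 : ℝ)‖}

end

noncomputable section

/-- A compact set mapped into itself by all the maps `x ↦ 1 / (x + m)`, `m ≥ 1`. -/
def truncDisc : Set ℂ := {x | ‖x‖ ≤ 2 ∧ -(1 / 2) ≤ x.re}

lemma isClosed_truncDisc : IsClosed truncDisc :=
  (isClosed_le continuous_norm continuous_const).inter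
    (isClosed_le continuous_const Complex.continuous_re)

instance : CompactSpace truncDisc :=
  isCompact_iff_compactSpace.mp <|
    (isCompact_closedBall (0 : ℂ) 2).of_isClosed_subset isClosed_truncDisc
      fun x hx => by simpa using hx.1

lemma re_add_nat_succ (x : ℂ) (m : ℕ) : (x + ((m : ℂ) + 1)).re = x.re + (m + 1) := by simp

lemma le_norm_shift {x : ℂ} (hx : x ∈ truncDisc) (m : ℕ) :
    (m : ℝ) + 1 / 2 ≤ ‖x + ((m : ℂ) + 1)‖ := by
  have h := Complex.re_le_norm (x + ((m : ℂ) + 1))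
  rw [re_add_nat_succ] at h
  linarith [hx.2]

lemma shift_ne_zero {x : ℂ} (hx : x ∈ truncDisc) (m : ℕ) : x + ((m : ℂ) + 1) ≠ 0 := by
  have h := le_norm_shift hx m
  have : (0 : ℝ) ≤ m := m.cast_nonneg
  exact norm_pos_iff.mp (by linarith)

lemma inv_re_nonneg {u : ℂ} (hu : 0 ≤ u.re) : 0 ≤ (u⁻¹).re := by
  rw [Complex.inv_re]; exact div_nonneg hu (Complex.normSq_nonneg u)

lemma inv_shift_mem {x : ℂ} (hx : x ∈ truncDisc) (m : ℕ) :
    (x + ((m : ℂ) + 1))⁻¹ ∈ truncDisc := by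
  have h := le_norm_shift hx m
  have hm : (0 : ℝ) ≤ m := m.cast_nonneg
  refine ⟨?_, ?_⟩
  · rw [norm_inv]
    calc ‖x + ((m : ℂ) + 1)‖⁻¹ ≤ (1 / 2 : ℝ)⁻¹ := by gcongr; linarith
      _ = 2 := by norm_num
  · have : 0 ≤ ((x + ((m : ℂ) + 1))⁻¹).re :=
      inv_re_nonneg (by rw [re_add_nat_succ]; linarith [hx.2])
    linarith

/-- The weight `x ↦ (x + m + 1)⁻³`. -/
def shiftWeight (m : ℕ) : C(truncDisc, ℂ) where
  toFun x := ((x : ℂ) + ((m : ℂ) + 1))⁻¹ ^ 3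
  continuous_toFun := by
    refine Continuous.pow (Continuous.inv₀ (by fun_prop) fun x => ?_) 3
    exact shift_ne_zero x.2 m

/-- The inverse branch `x ↦ 1 / (x + m + 1)` of the Gauss map. -/
def gaussBranch (m : ℕ) : C(truncDisc, truncDisc) where
  toFun x := ⟨((x : ℂ) + ((m : ℂ) + 1))⁻¹, inv_shift_mem x.2 m⟩
  continuous_toFun := by
    refine Continuous.subtype_mk (Continuous.inv₀ (by fun_prop) fun x => ?_) _
    exact shift_ne_zero x.2 m

/-- One term of the transfer operator. -/
def transferTerm (m : ℕ) : C(truncDisc, ℂ) →L[ℂ] C(truncDisc, ℂ) :=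
  (ContinuousLinearMap.mul ℂ C(truncDisc, ℂ) (shiftWeight m)).comp
    (ContinuousMap.compCLM ℂ ℂ (gaussBranch m))

lemma transferTerm_apply (m : ℕ) (f : C(truncDisc, ℂ)) (x : truncDisc) :
    transferTerm m f x = ((x : ℂ) + ((m : ℂ) + 1))⁻¹ ^ 3 * f (gaussBranch m x) := rfl

/-- The transfer operator `f ↦ ∑ (x + m)⁻³ f (1 / (x + m))`. -/
def transfer : C(truncDisc, ℂ) →L[ℂ] C(truncDisc, ℂ) := ∑' m, transferTerm m

lemma norm_inv_shift_le {x : ℂ} (hx : x ∈ truncDisc) (m : ℕ) :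
    ‖(x + ((m : ℂ) + 1))⁻¹‖ ≤ 2 * ((m : ℝ) + 1)⁻¹ := by
  have h := le_norm_shift hx m
  have hm : (0 : ℝ) ≤ m := m.cast_nonneg
  rw [norm_inv, ← div_eq_mul_inv, inv_le_comm₀ (by linarith) (by positivity), inv_div]
  linarith

lemma summable_inv_succ_sq : Summable fun m : ℕ => (((m : ℝ) + 1)⁻¹) ^ 2 := by
  have h := (summable_nat_add_iff 1).mpr (Real.summable_nat_pow_inv.mpr (le_refl 2))
  simpa using h

lemma norm_transferTerm_le (m : ℕ) : ‖transferTerm m‖ ≤ 8 * (((m : ℝ) + 1)⁻¹) ^ 2 := by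
  refine ContinuousLinearMap.opNorm_le_bound _ (by positivity) fun f => ?_
  rw [ContinuousMap.norm_le _ (by positivity)]
  intro x
  rw [transferTerm_apply, norm_mul, norm_pow]
  have h := norm_inv_shift_le x.2 m
  have h1 : ((m : ℝ) + 1)⁻¹ ≤ 1 := inv_le_one_of_one_le₀ (by linarith [m.cast_nonneg (α := ℝ)])
  have h0 : 0 ≤ ((m : ℝ) + 1)⁻¹ := by positivity
  have hf := f.norm_coe_le_norm (gaussBranch m x)
  have : ‖((x : ℂ) + ((m : ℂ) + 1))⁻¹‖ ^ 3 ≤ 8 * (((m : ℝ) + 1)⁻¹) ^ 2 :=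
    calc _ ≤ (2 * ((m : ℝ) + 1)⁻¹) ^ 3 := by gcongr
      _ = 8 * (((m : ℝ) + 1)⁻¹) ^ 2 * ((m : ℝ) + 1)⁻¹ := by ring
      _ ≤ 8 * (((m : ℝ) + 1)⁻¹) ^ 2 * 1 := by gcongr
      _ = _ := mul_one _
  gcongr

lemma hasSum_transferTerm : HasSum transferTerm transfer :=
  (Summable.of_norm_bounded (summable_inv_succ_sq.mul_left 8) norm_transferTerm_le).hasSum

lemma hasSum_transfer_apply (f : C(truncDisc, ℂ)) (x : truncDisc) :
    HasSum (fun m : ℕ => ((x : ℂ) + ((m : ℂ) + 1))⁻¹ ^ 3 * f (gaussBranch m x))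
      (transfer f x) := by
  have h := hasSum_transferTerm.mapL (ContinuousLinearMap.apply ℂ C(truncDisc, ℂ) f)
  exact h.mapL (ContinuousMap.evalCLM ℂ x)

/-- A weight which the transfer operator contracts by the factor `(√5 - 1) / 2`. -/
def contractionWeight (x : ℂ) : ℝ := (‖x + (Real.goldenRatio : ℂ)‖ * (1 + x.re))⁻¹

lemma hasSum_inv_mul_inv_succ {s : ℝ} (hs : -1 < s) :
    HasSum (fun m : ℕ => ((s + (m + 1)) * (s + (m + 1) + 1))⁻¹) (1 + s)⁻¹ := by
  have hpos : ∀ m : ℕ, 0 < s + (m + 1) := fun m => by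
    linarith [m.cast_nonneg (α := ℝ)]
  rw [hasSum_iff_tendsto_nat_of_nonneg fun m => by have := hpos m; positivity]
  have hpart : ∀ n : ℕ, ∑ m ∈ Finset.range n, ((s + ((m : ℝ) + 1)) * (s + (m + 1) + 1))⁻¹
      = (1 + s)⁻¹ - (s + (n + 1))⁻¹ := by
    intro n
    induction n with
    | zero => simp [add_comm]
    | succ n ih =>
      rw [Finset.sum_range_succ, ih]
      have h1 := (hpos n).ne'
      have h2 := (hpos (n + 1)).ne'
      have h3 := (hpos 0).ne'
      push_cast at h2 h3 ⊢
      have h4 : 1 + s ≠ 0 := by intro h; apply h3; linarith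
      have h5 : s + (n + 1) + 1 ≠ 0 := by intro h; apply h2; linarith
      field_simp
      ring
  simp_rw [hpart]
  have h : Tendsto (fun n : ℕ => (s + ((n : ℝ) + 1))⁻¹) atTop (𝓝 0) :=
    tendsto_inv_atTop_zero.comp <| tendsto_atTop_add_const_left _ _ <|
      tendsto_atTop_add_const_right _ _ tendsto_natCast_atTop_atTop
  simpa using h.const_sub ((1 + s)⁻¹)

lemma contractionWeight_branch_le {x : ℂ} (hx : x ∈ truncDisc) (m : ℕ) :
    ‖(x + ((m : ℂ) + 1))⁻¹‖ ^ 3 * contractionWeight (x + ((m : ℂ) + 1))⁻¹ ≤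
      Real.goldenRatio⁻¹ * ‖x + (Real.goldenRatio : ℂ)‖⁻¹ *
        ((x.re + (m + 1)) * (x.re + (m + 1) + 1))⁻¹ := by
  set G := Real.goldenRatio with hG
  have hG0 : 0 < G := Real.goldenRatio_pos
  have hG1 : 1 < G := Real.one_lt_goldenRatio
  have hGsq : G ^ 2 = G + 1 := Real.goldenRatio_sq
  set y := x + ((m : ℂ) + 1) with hy
  have hy0 : y ≠ 0 := shift_ne_zero hx m
  have hm : (0 : ℝ) ≤ m := m.cast_nonneg
  have hre : y.re = x.re + (m + 1) := re_add_nat_succ x m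
  have hxre := hx.2
  have hs : 0 < y.re := by rw [hre]; linarith
  have hn : 0 < ‖y‖ := norm_pos_iff.mpr hy0
  have hsn : y.re ≤ ‖y‖ := Complex.re_le_norm y
  have hinv : (y⁻¹).re = y.re / ‖y‖ ^ 2 := by rw [Complex.inv_re, Complex.normSq_eq_norm_sq]
  have hxG : 0 < ‖x + (G : ℂ)‖ :=
    lt_of_lt_of_le (by simp; linarith) (Complex.re_le_norm _)
  have hfac : ‖y‖ * ‖y⁻¹ + (G : ℂ)‖ = ‖1 + (G : ℂ) * y‖ := by
    rw [← norm_mul]; congr 1; field_simp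
  have hle : ‖x + (G : ℂ)‖ * G ≤ ‖1 + (G : ℂ) * y‖ := by
    have e : 1 + (G : ℂ) * y = (G : ℂ) * (x + G + m) := by
      have : (G : ℂ) ^ 2 = G + 1 := by exact_mod_cast hGsq
      rw [hy]; linear_combination -this
    rw [e, norm_mul, Complex.norm_real, Real.norm_of_nonneg hG0.le, mul_comm]
    refine mul_le_mul_of_nonneg_left ?_ hG0.le
    rw [← sq_le_sq₀ (norm_nonneg _) (norm_nonneg _), ← Complex.normSq_eq_norm_sq,
      ← Complex.normSq_eq_norm_sq, Complex.normSq_apply, Complex.normSq_apply]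
    simp
    nlinarith
  unfold contractionWeight
  rw [hinv, norm_inv, ← hre, ← hG, inv_pow, ← mul_inv, ← mul_inv, ← mul_inv]
  refine inv_anti₀ (by positivity) ?_
  have e2 : ‖y‖ ^ 3 * (‖y⁻¹ + (G : ℂ)‖ * (1 + y.re / ‖y‖ ^ 2)) =
      (‖y‖ * ‖y⁻¹ + (G : ℂ)‖) * (‖y‖ ^ 2 + y.re) := by field_simp
  rw [e2, hfac]
  have h3 : y.re * (y.re + 1) ≤ ‖y‖ ^ 2 + y.re := by nlinarith
  calc G * ‖x + (G : ℂ)‖ * (y.re * (y.re + 1)) = ‖x + (G : ℂ)‖ * G * (y.re * (y.re + 1)) := by ring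
    _ ≤ _ := by gcongr

lemma norm_transfer_apply_le {f : C(truncDisc, ℂ)} {B : ℝ} (hB : 0 ≤ B)
    (hf : ∀ x : truncDisc, ‖f x‖ ≤ B * contractionWeight x) (x : truncDisc) :
    ‖transfer f x‖ ≤ Real.goldenRatio⁻¹ * B * contractionWeight x := by
  rw [← (hasSum_transfer_apply f x).tsum_eq]
  have hs : (-1 : ℝ) < (x : ℂ).re := by linarith [x.2.2]
  have h := (hasSum_inv_mul_inv_succ hs).mul_left
    (B * (Real.goldenRatio⁻¹ * ‖(x : ℂ) + (Real.goldenRatio : ℂ)‖⁻¹))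
  have e : B * (Real.goldenRatio⁻¹ * ‖(x : ℂ) + (Real.goldenRatio : ℂ)‖⁻¹) * (1 + (x : ℂ).re)⁻¹ =
      Real.goldenRatio⁻¹ * B * contractionWeight x := by
    unfold contractionWeight; rw [mul_inv]; ring
  rw [e] at h
  refine tsum_of_norm_bounded h fun m => ?_
  rw [norm_mul, norm_pow]
  calc _ ≤ ‖((x : ℂ) + ((m : ℂ) + 1))⁻¹‖ ^ 3 *
        (B * contractionWeight ((x : ℂ) + ((m : ℂ) + 1))⁻¹) := by
        gcongr; exact hf (gaussBranch m x)
    _ = B * (‖((x : ℂ) + ((m : ℂ) + 1))⁻¹‖ ^ 3 *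
        contractionWeight ((x : ℂ) + ((m : ℂ) + 1))⁻¹) := by ring
    _ ≤ _ := by
      rw [mul_assoc B]
      exact mul_le_mul_of_nonneg_left (contractionWeight_branch_le x.2 m) hB

lemma contractionWeight_le {x : ℂ} (hx : x ∈ truncDisc) : contractionWeight x ≤ 4 := by
  have h1 := Real.one_lt_goldenRatio
  have h2 : (1 / 2 : ℝ) ≤ ‖x + (Real.goldenRatio : ℂ)‖ := by
    refine le_trans ?_ (Complex.re_le_norm _)
    rw [Complex.add_re, Complex.ofReal_re]; linarith [hx.2]
  have h3 : (1 / 2 : ℝ) ≤ 1 + x.re := by linarith [hx.2]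
  calc contractionWeight x ≤ ((1 / 2) * (1 / 2) : ℝ)⁻¹ := by unfold contractionWeight; gcongr
    _ = 4 := by norm_num

lemma le_contractionWeight {x : ℂ} (hx : x ∈ truncDisc) : 1 ≤ 12 * contractionWeight x := by
  have h1 := Real.one_lt_goldenRatio
  have h1' := Real.goldenRatio_lt_two
  have h2 : ‖x + (Real.goldenRatio : ℂ)‖ ≤ 4 := by
    refine (norm_add_le _ _).trans ?_
    rw [Complex.norm_real, Real.norm_of_nonneg (by linarith)]; linarith [hx.1]
  have h2' : 0 < ‖x + (Real.goldenRatio : ℂ)‖ :=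
    lt_of_lt_of_le (by rw [Complex.add_re, Complex.ofReal_re]; linarith [hx.2]) (Complex.re_le_norm _)
  have h3 : 1 + x.re ≤ 3 := by linarith [(Complex.re_le_norm x).trans hx.1]
  have h3' : 0 < 1 + x.re := by linarith [hx.2]
  unfold contractionWeight
  rw [← div_eq_mul_inv, le_div_iff₀ (by positivity)]
  nlinarith

lemma norm_transfer_pow_le (r : ℕ) : ‖transfer ^ r‖ ≤ 48 * Real.goldenRatio⁻¹ ^ r := by
  have hG : 0 < Real.goldenRatio := Real.goldenRatio_pos
  refine ContinuousLinearMap.opNorm_le_bound _ (by positivity) fun f => ?_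
  have key : ∀ x : truncDisc, ‖(transfer ^ r) f x‖ ≤
      Real.goldenRatio⁻¹ ^ r * (12 * ‖f‖) * contractionWeight x := by
    induction r with
    | zero =>
      intro x
      have h1 := le_contractionWeight x.2
      have h2 := f.norm_coe_le_norm x
      rw [pow_zero, one_apply_eq_self]
      nlinarith [norm_nonneg f]
    | succ r ih =>
      intro x
      rw [pow_succ', mul_apply_eq_comp]
      refine (norm_transfer_apply_le (by positivity) ih x).trans (le_of_eq ?_)
      ring
  rw [ContinuousMap.norm_le _ (by positivity)]
  intro x
  calc _ ≤ _ := key x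
    _ ≤ Real.goldenRatio⁻¹ ^ r * (12 * ‖f‖) * 4 := by gcongr; exact contractionWeight_le x.2
    _ = _ := by ring

/-- The inclusion of `truncDisc` into `ℂ`. -/
def truncDiscIncl : C(truncDisc, ℂ) := ⟨Subtype.val, continuous_subtype_val⟩

/-- The Cauchy kernel `x ↦ 1 / (z - x)` on `truncDisc`. -/
def cauchyKernel (z : ℂ) : C(truncDisc, ℂ) := resolvent truncDiscIncl z

lemma sub_truncDisc_ne_zero {z : ℂ} (hz : z ∉ truncDisc) (x : truncDisc) : z - x ≠ 0 :=
  sub_ne_zero.mpr fun h => hz (h ▸ x.2)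

lemma mem_resolventSet_incl {z : ℂ} (hz : z ∉ truncDisc) :
    z ∈ resolventSet ℂ truncDiscIncl := by
  rw [spectrum.mem_resolventSet_iff, ContinuousMap.isUnit_iff_forall_ne_zero]
  exact sub_truncDisc_ne_zero hz

lemma cauchyKernel_apply {z : ℂ} (hz : z ∉ truncDisc) (x : truncDisc) :
    cauchyKernel z x = (z - x)⁻¹ := by
  have h := Ring.inverse_mul_cancel _ (mem_resolventSet_incl hz)
  have h2 := DFunLike.congr_fun h x
  exact eq_inv_of_mul_eq_one_left h2

lemma norm_cauchyKernel_le {z : ℂ} (hz : z ∉ truncDisc) {δ : ℝ} (hδ : 0 < δ)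
    (h : ∀ x ∈ truncDisc, δ ≤ ‖z - x‖) : ‖cauchyKernel z‖ ≤ δ⁻¹ := by
  rw [ContinuousMap.norm_le _ (by positivity)]
  intro x
  rw [cauchyKernel_apply hz, norm_inv]
  exact inv_anti₀ hδ (h x x.2)

lemma quarter_le_norm_sub {w x : ℂ} (hw : 3 < ‖w‖ ∨ w.re < -(3 / 4)) (hx : x ∈ truncDisc) :
    1 / 4 ≤ ‖w - x‖ := by
  rcases hw with hw | hw
  · linarith [norm_sub_norm_le w x, hx.1]
  · have h := Complex.abs_re_le_norm (w - x)
    rw [Complex.sub_re] at h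
    linarith [hx.2, neg_abs_le (w.re - x.re)]

lemma notMem_truncDisc_of_far {w : ℂ} (hw : 3 < ‖w‖ ∨ w.re < -(3 / 4)) : w ∉ truncDisc := by
  intro h
  have := quarter_le_norm_sub hw h
  norm_num at this

lemma neg_succ_notMem (m : ℕ) : -((m : ℂ) + 1) ∉ truncDisc := by
  intro h
  have h2 := h.2
  simp at h2
  linarith [m.cast_nonneg (α := ℝ)]

lemma norm_cauchyKernel_neg_succ_le (m : ℕ) : ‖cauchyKernel (-((m : ℂ) + 1))‖ ≤ 2 := by
  rw [show (2 : ℝ) = (1 / 2)⁻¹ by norm_num]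
  refine norm_cauchyKernel_le (neg_succ_notMem m) (by norm_num) fun x hx => ?_
  rw [show -((m : ℂ) + 1) - x = -(x + ((m : ℂ) + 1)) by ring, norm_neg]
  linarith [le_norm_shift hx m, m.cast_nonneg (α := ℝ)]

/-- `φ` is the Cauchy transform of the functional `ℓ` outside `truncDisc`. -/
def IsCauchyTransform (φ : ℂ → ℂ) (ℓ : C(truncDisc, ℂ) →L[ℂ] ℂ) : Prop :=
  ∀ z ∉ truncDisc, φ z = ℓ (cauchyKernel z)

lemma IsCauchyTransform.deriv_eq {φ : ℂ → ℂ} {ℓ : C(truncDisc, ℂ) →L[ℂ] ℂ}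
    (h : IsCauchyTransform φ ℓ) {z : ℂ} (hz : z ∉ truncDisc) :
    deriv φ z = ℓ (-cauchyKernel z ^ 2) := by
  have h1 : HasDerivAt (fun w => ℓ (cauchyKernel w)) (ℓ (-cauchyKernel z ^ 2)) z :=
    ℓ.hasFDerivAt.comp_hasDerivAt z
      (spectrum.hasDerivAt_resolvent_const_left (mem_resolventSet_incl hz))
  refine (h1.congr_of_eventuallyEq ?_).deriv
  filter_upwards [isClosed_truncDisc.isOpen_compl.mem_nhds hz] with w hw using h w hw

/-- The action of a term of `T` on Cauchy kernels. -/
def kernelTerm (m : ℕ) (z : ℂ) : C(truncDisc, ℂ) :=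
  (-z) • (cauchyKernel (z⁻¹ - ((m : ℂ) + 1)) - cauchyKernel (-((m : ℂ) + 1))) -
    cauchyKernel (-((m : ℂ) + 1)) ^ 2

lemma IsCauchyTransform.Tterm_eq {φ : ℂ → ℂ} {ℓ : C(truncDisc, ℂ) →L[ℂ] ℂ}
    (h : IsCauchyTransform φ ℓ) {m : ℕ} {z : ℂ} (hw : z⁻¹ - ((m : ℂ) + 1) ∉ truncDisc) :
    Tterm φ m z = ℓ (kernelTerm m z) := by
  rw [Tterm, h _ hw, h _ (neg_succ_notMem m), h.deriv_eq (neg_succ_notMem m), kernelTerm,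
    map_sub, map_smul, map_sub, map_neg, smul_eq_mul]
  ring

lemma kernelTerm_apply {m : ℕ} {z : ℂ} (hz : z ≠ 0) (hw : z⁻¹ - ((m : ℂ) + 1) ∉ truncDisc)
    (x : truncDisc) :
    kernelTerm m z x = ((x : ℂ) + ((m : ℂ) + 1))⁻¹ ^ 2 *
      (z * (x - (z⁻¹ - ((m : ℂ) + 1))))⁻¹ := by
  have hy := shift_ne_zero x.2 m
  have hwx := sub_truncDisc_ne_zero hw x
  have h1 : kernelTerm m z x = (-z) * ((z⁻¹ - ((m : ℂ) + 1) - x)⁻¹ - (-((m : ℂ) + 1) - x)⁻¹) -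
      ((-((m : ℂ) + 1) - x)⁻¹) ^ 2 := by
    rw [← cauchyKernel_apply hw, ← cauchyKernel_apply (neg_succ_notMem m)]; rfl
  rw [h1]
  set y : ℂ := (x : ℂ) + ((m : ℂ) + 1) with hydef
  have e1 : z⁻¹ - ((m : ℂ) + 1) - x = z⁻¹ - y := by rw [hydef]; ring
  have e2 : -((m : ℂ) + 1) - x = -y := by rw [hydef]; ring
  have e3 : z * (x - (z⁻¹ - ((m : ℂ) + 1))) = -(1 - z * y) := by
    rw [hydef]; field_simp; ring
  rw [e1] at hwx
  have e4 : z⁻¹ - y = z⁻¹ * (1 - z * y) := by field_simp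
  have h5 : 1 - z * y ≠ 0 := fun h => hwx (by rw [e4, h, mul_zero])
  rw [e1, e2, e3, e4]
  field_simp
  ring

lemma inv_sub_notMem {z : ℂ} (hz : z ∉ truncDisc) (m : ℕ) :
    z⁻¹ - ((m : ℂ) + 1) ∉ truncDisc := by
  intro h
  apply hz
  have := inv_shift_mem h m
  rwa [sub_add_cancel, inv_inv] at this

lemma kernelTerm_eq_transferTerm {z : ℂ} (hz : z ∉ truncDisc) (m : ℕ) :
    kernelTerm m z = transferTerm m (cauchyKernel z) := by
  have hz0 : z ≠ 0 := by
    rintro rfl; exact hz (by simp [truncDisc])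
  ext x
  rw [kernelTerm_apply hz0 (inv_sub_notMem hz m), transferTerm_apply, cauchyKernel_apply hz]
  have hy := shift_ne_zero x.2 m
  have h2 : z - ((x : ℂ) + ((m : ℂ) + 1))⁻¹ ≠ 0 := sub_truncDisc_ne_zero hz (gaussBranch m x)
  change _ = _ * (z - ((x : ℂ) + ((m : ℂ) + 1))⁻¹)⁻¹
  have e : z * (x - (z⁻¹ - ((m : ℂ) + 1))) =
      ((x : ℂ) + ((m : ℂ) + 1)) * (z - ((x : ℂ) + ((m : ℂ) + 1))⁻¹) := by
    field_simp; ring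
  rw [e, mul_inv]
  ring

lemma IsCauchyTransform.map_Tbrj {φ : ℂ → ℂ} {ℓ : C(truncDisc, ℂ) →L[ℂ] ℂ}
    (h : IsCauchyTransform φ ℓ) : IsCauchyTransform (Tbrj φ) (ℓ.comp transfer) := by
  intro z hz
  have h1 := (hasSum_transferTerm.mapL
    (ContinuousLinearMap.apply ℂ C(truncDisc, ℂ) (cauchyKernel z))).mapL ℓ
  have h2 : (fun m => Tterm φ m z) = fun m => ℓ (transferTerm m (cauchyKernel z)) :=
    funext fun m => by rw [h.Tterm_eq (inv_sub_notMem hz m), kernelTerm_eq_transferTerm hz]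
  rw [Tbrj, h2]
  exact h1.tsum_eq

lemma IsCauchyTransform.iterate_Tbrj {φ : ℂ → ℂ} {ℓ : C(truncDisc, ℂ) →L[ℂ] ℂ}
    (h : IsCauchyTransform φ ℓ) (r : ℕ) :
    IsCauchyTransform (Tbrj^[r] φ) (ℓ.comp (transfer ^ r)) := by
  induction r with
  | zero => exact h
  | succ r ih =>
    rw [Function.iterate_succ_apply']
    exact ih.map_Tbrj

lemma IsCauchyTransform.norm_le_of_far {φ : ℂ → ℂ} {ℓ : C(truncDisc, ℂ) →L[ℂ] ℂ}
    (h : IsCauchyTransform φ ℓ) {w : ℂ} (hw : 3 < ‖w‖ ∨ w.re < -(3 / 4)) :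
    ‖φ w‖ ≤ 4 * ‖ℓ‖ := by
  have hw' := notMem_truncDisc_of_far hw
  have hk := norm_cauchyKernel_le hw' (by norm_num : (0 : ℝ) < 1 / 4)
    fun x hx => quarter_le_norm_sub hw hx
  rw [h w hw']
  calc _ ≤ ‖ℓ‖ * ‖cauchyKernel w‖ := ℓ.le_opNorm _
    _ ≤ ‖ℓ‖ * (1 / 4)⁻¹ := by gcongr
    _ = _ := by norm_num; ring

lemma norm_kernelTerm_le_of_far {m : ℕ} {z : ℂ} (hz : 1 / 10 ≤ ‖z‖)
    (hw : 3 < ‖z⁻¹ - ((m : ℂ) + 1)‖ ∨ (z⁻¹ - ((m : ℂ) + 1)).re < -(3 / 4)) :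
    ‖kernelTerm m z‖ ≤ 160 * (((m : ℝ) + 1)⁻¹) ^ 2 := by
  have hz0 : z ≠ 0 := norm_pos_iff.mp (by linarith)
  rw [ContinuousMap.norm_le _ (by positivity)]
  intro x
  rw [kernelTerm_apply hz0 (notMem_truncDisc_of_far hw), norm_mul, norm_pow, norm_inv (z * _),
    norm_mul, norm_sub_rev]
  have h1 := norm_inv_shift_le x.2 m
  have h2 : (‖z‖ * ‖z⁻¹ - ((m : ℂ) + 1) - x‖)⁻¹ ≤ (1 / 10 * (1 / 4) : ℝ)⁻¹ := by
    gcongr; exact quarter_le_norm_sub hw x.2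
  calc _ ≤ (2 * ((m : ℝ) + 1)⁻¹) ^ 2 * (1 / 10 * (1 / 4) : ℝ)⁻¹ := by gcongr
    _ = _ := by ring

lemma IsCauchyTransform.norm_Tterm_le {φ : ℂ → ℂ} {ℓ : C(truncDisc, ℂ) →L[ℂ] ℂ}
    (h : IsCauchyTransform φ ℓ) {m : ℕ} {z : ℂ} {B : ℝ} (hz : 1 / 10 ≤ ‖z‖)
    (hB : ‖φ (z⁻¹ - ((m : ℂ) + 1))‖ ≤ B) :
    ‖Tterm φ m z‖ ≤ 2028 * (B + ‖ℓ‖) * (((m : ℝ) + 1)⁻¹) ^ 2 := by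
  have hB0 : 0 ≤ B := (norm_nonneg _).trans hB
  by_cases hw : 3 < ‖z⁻¹ - ((m : ℂ) + 1)‖ ∨ (z⁻¹ - ((m : ℂ) + 1)).re < -(3 / 4)
  · rw [h.Tterm_eq (notMem_truncDisc_of_far hw)]
    calc _ ≤ ‖ℓ‖ * ‖kernelTerm m z‖ := ℓ.le_opNorm _
      _ ≤ ‖ℓ‖ * (160 * (((m : ℝ) + 1)⁻¹) ^ 2) := by
        gcongr; exact norm_kernelTerm_le_of_far hz hw
      _ = 160 * ‖ℓ‖ * (((m : ℝ) + 1)⁻¹) ^ 2 := by ring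
      _ ≤ _ := by gcongr <;> [norm_num; linarith]
  · push Not at hw
    obtain ⟨hw1, hw2⟩ := hw
    have hm0 : (0 : ℝ) ≤ m := m.cast_nonneg
    have hz0 : 0 < ‖z‖ := by linarith
    have hinv : ‖z⁻¹‖ ≤ 10 := by
      rw [norm_inv]
      calc ‖z‖⁻¹ ≤ (1 / 10 : ℝ)⁻¹ := by gcongr
        _ = 10 := by norm_num
    have hnm : ‖((m : ℂ) + 1)‖ = (m : ℝ) + 1 := by
      rw [← Nat.cast_succ, Complex.norm_natCast, Nat.cast_succ]
    have hm13 : (m : ℝ) + 1 ≤ 13 := by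
      have := norm_sub_norm_le ((m : ℂ) + 1) z⁻¹
      rw [norm_sub_rev, hnm] at this
      linarith
    have hre : 1 / 4 ≤ ‖z‖⁻¹ := by
      have h1 := Complex.re_le_norm z⁻¹
      rw [Complex.sub_re, show ((m : ℂ) + 1).re = (m : ℝ) + 1 by simp] at hw2
      rw [norm_inv] at h1
      linarith
    have hz4 : ‖z‖ ≤ 4 := by
      rw [le_inv_comm₀ (by norm_num) hz0] at hre
      linarith
    have hk := norm_cauchyKernel_neg_succ_le m
    have hval : ‖φ (-((m : ℂ) + 1))‖ ≤ 2 * ‖ℓ‖ := by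
      rw [h _ (neg_succ_notMem m)]
      exact (ℓ.le_opNorm _).trans (by nlinarith [norm_nonneg ℓ])
    have hder : ‖deriv φ (-((m : ℂ) + 1))‖ ≤ 4 * ‖ℓ‖ := by
      rw [h.deriv_eq (neg_succ_notMem m)]
      refine (ℓ.le_opNorm _).trans ?_
      have : ‖-cauchyKernel (-((m : ℂ) + 1)) ^ 2‖ ≤ 4 := by
        rw [norm_neg]
        refine (norm_pow_le' _ two_pos).trans ?_
        nlinarith [norm_nonneg (cauchyKernel (-((m : ℂ) + 1)))]
      nlinarith [norm_nonneg ℓ]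
    have hterm : ‖Tterm φ m z‖ ≤ 12 * (B + ‖ℓ‖) := by
      unfold Tterm
      refine (norm_add_le _ _).trans ?_
      rw [norm_mul, norm_neg]
      have h1 : ‖φ (z⁻¹ - ((m : ℂ) + 1)) - φ (-((m : ℂ) + 1))‖ ≤ B + 2 * ‖ℓ‖ :=
        (norm_sub_le _ _).trans (by linarith)
      have h2 : ‖z‖ * ‖φ (z⁻¹ - ((m : ℂ) + 1)) - φ (-((m : ℂ) + 1))‖ ≤ 4 * (B + 2 * ‖ℓ‖) := by
        gcongr
      linarith [norm_nonneg ℓ]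
    have hsq : 1 ≤ 169 * (((m : ℝ) + 1)⁻¹) ^ 2 := by
      have : (13 : ℝ)⁻¹ ≤ ((m : ℝ) + 1)⁻¹ := by gcongr
      nlinarith
    have hnn : 0 ≤ 12 * (B + ‖ℓ‖) := by positivity
    nlinarith

/-- The constant in the one-step estimate `IsCauchyTransform.norm_Tbrj_le`. -/
def stepConst : ℝ := 2028 * ∑' m : ℕ, (((m : ℝ) + 1)⁻¹) ^ 2

lemma stepConst_nonneg : 0 ≤ stepConst :=
  mul_nonneg (by norm_num) (tsum_nonneg fun m => by positivity)

lemma IsCauchyTransform.norm_Tbrj_le {φ : ℂ → ℂ} {ℓ : C(truncDisc, ℂ) →L[ℂ] ℂ}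
    (h : IsCauchyTransform φ ℓ) {z : ℂ} {B : ℝ} (hz : 1 / 10 ≤ ‖z‖)
    (hB : ∀ m : ℕ, ‖φ (z⁻¹ - ((m : ℂ) + 1))‖ ≤ B) :
    ‖Tbrj φ z‖ ≤ stepConst * (B + ‖ℓ‖) := by
  have hs := summable_inv_succ_sq.hasSum.mul_left (2028 * (B + ‖ℓ‖))
  refine (tsum_of_norm_bounded hs fun m => h.norm_Tterm_le hz (hB m)).trans (le_of_eq ?_)
  rw [stepConst]; ring

lemma sqrt_three_bounds : (1.73 : ℝ) < Real.sqrt 3 ∧ Real.sqrt 3 < 1.74 :=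
  ⟨Real.lt_sqrt_of_sq_lt (by norm_num), (Real.sqrt_lt' (by norm_num)).mpr (by norm_num)⟩

lemma inv_notMem_Dinf {u : ℂ} (hre : Real.sqrt 3 / 2 ≤ u.re)
    (him : 2 * |u.im| ≤ u.re ^ 2 + u.im ^ 2) : u⁻¹ ∉ Dinf := by
  obtain ⟨h3, h3'⟩ := sqrt_three_bounds
  have hsq : Real.sqrt 3 ^ 2 = 3 := Real.sq_sqrt (by norm_num)
  have hn : Complex.normSq u = u.re ^ 2 + u.im ^ 2 := by rw [Complex.normSq_apply]; ring
  have hn0 : 0 < Complex.normSq u := by rw [hn]; nlinarith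
  rintro ((h | h) | ⟨-, h⟩)
  · simp only [mem_ofPred_eq, Complex.inv_im, abs_div, abs_neg, abs_of_pos hn0] at h
    rw [lt_div_iff₀ hn0, hn] at h
    linarith
  · have := inv_re_nonneg (u := u) (by linarith)
    simp only [mem_ofPred_eq] at h
    linarith
  · refine absurd h (not_lt.mpr ?_)
    have h0 : (0 : ℝ) ≤ 1 / Real.sqrt 3 := by positivity
    rw [← sq_le_sq₀ (norm_nonneg _) h0, ← Complex.normSq_eq_norm_sq, Complex.normSq_apply]
    simp only [Complex.sub_re, Complex.sub_im, Complex.ofReal_re, Complex.ofReal_im,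
      Complex.inv_re, Complex.inv_im]
    have h1 : 1 ≤ 2 * (1 / Real.sqrt 3) * u.re := by
      rw [mul_one_div, div_mul_eq_mul_div, le_div_iff₀ (by linarith)]; linarith
    have e : (u.re / Complex.normSq u - 1 / Real.sqrt 3) * (u.re / Complex.normSq u - 1 / Real.sqrt 3) +
        (-u.im / Complex.normSq u - 0) * (-u.im / Complex.normSq u - 0) =
        (1 / Real.sqrt 3) ^ 2 + (1 - 2 * (1 / Real.sqrt 3) * u.re) / Complex.normSq u := by
      field_simp
      rw [hn]; ring
    rw [e]
    have : (1 - 2 * (1 / Real.sqrt 3) * u.re) / Complex.normSq u ≤ 0 :=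
      div_nonpos_of_nonpos_of_nonneg (by linarith) hn0.le
    linarith

lemma norm_ge_of_mem_Dinf {z : ℂ} (hz : z ∈ Dinf) : 1 / 10 ≤ ‖z‖ := by
  obtain ⟨h3, h3'⟩ := sqrt_three_bounds
  have h1 := Complex.abs_re_le_norm z
  have h2 := Complex.abs_im_le_norm z
  rcases hz with (h | h) | ⟨h, -⟩
  · simp only [mem_ofPred_eq] at h; linarith
  · simp only [mem_ofPred_eq] at h; linarith [neg_abs_le z.re]
  · linarith [le_abs_self z.re]

lemma inv_sub_mem_Dinf {z : ℂ} (hz : z ∈ Dinf) (m : ℕ) : z⁻¹ - ((m : ℂ) + 1) ∈ Dinf := by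
  have hm : (0 : ℝ) ≤ m := m.cast_nonneg
  by_contra hw
  have h3 : Real.sqrt 3 ^ 2 = 3 := Real.sq_sqrt (by norm_num)
  have h3' := sqrt_three_bounds
  simp only [Dinf, mem_union, mem_ofPred_eq, not_or, not_lt, Complex.sub_re, Complex.sub_im,
    Complex.add_re, Complex.add_im, Complex.natCast_re, Complex.natCast_im, Complex.one_re,
    Complex.one_im, add_zero, sub_zero] at hw
  obtain ⟨⟨him, hre⟩, -⟩ := hw
  have hre' : Real.sqrt 3 / 2 ≤ (z⁻¹).re := by linarith
  refine inv_notMem_Dinf hre' ?_ ((inv_inv z).symm ▸ hz)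
  rw [← sq_abs (z⁻¹).im]
  nlinarith [abs_nonneg (z⁻¹).im]

lemma inv_sub_near_of_mem_Dinf {z : ℂ} (hz : z ∈ Dinf) (m : ℕ) :
    (z⁻¹ - ((m : ℂ) + 1)).re < -(1 / 10) ∨ 5 / 9 < |(z⁻¹ - ((m : ℂ) + 1)).im| := by
  have hm : (0 : ℝ) ≤ m := m.cast_nonneg
  by_contra! hw
  have h3' := sqrt_three_bounds
  simp only [Complex.sub_re, Complex.sub_im,
    Complex.add_re, Complex.add_im, Complex.natCast_re, Complex.natCast_im, Complex.one_re,
    Complex.one_im, add_zero, sub_zero] at hw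
  obtain ⟨hre, him⟩ := hw
  have hre' : 9 / 10 ≤ (z⁻¹).re := by linarith
  refine inv_notMem_Dinf (by linarith) ?_ ((inv_inv z).symm ▸ hz)
  rw [← sq_abs (z⁻¹).im]
  nlinarith [abs_nonneg (z⁻¹).im]

lemma inv_sub_re_lt_of_near {z : ℂ} (hz : z.re < -(1 / 10) ∨ 5 / 9 < |z.im|) (m : ℕ) :
    (z⁻¹ - ((m : ℂ) + 1)).re < -(1 / 10) := by
  have hm : (0 : ℝ) ≤ m := m.cast_nonneg
  by_contra! hw
  simp only [Complex.sub_re, Complex.add_re, Complex.natCast_re, Complex.one_re] at hw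
  obtain ⟨u, rfl⟩ : ∃ u : ℂ, z = u⁻¹ := ⟨z⁻¹, (inv_inv z).symm⟩
  rw [inv_inv] at hw
  have hre' : 9 / 10 ≤ u.re := by linarith
  rcases hz with h | h
  · linarith [inv_re_nonneg (u := u) (by linarith)]
  · have hn : Complex.normSq u = u.re ^ 2 + |u.im| ^ 2 := by
      rw [Complex.normSq_apply, sq_abs]; ring
    have hn0 : 0 < Complex.normSq u := by rw [hn]; nlinarith [sq_nonneg |u.im|]
    rw [Complex.inv_im, abs_div, abs_neg, abs_of_pos hn0, lt_div_iff₀ hn0, hn] at h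
    nlinarith [sq_nonneg (|u.im| - 9 / 10)]

lemma inv_sub_re_lt_of_re_neg {z : ℂ} (hz : z.re < 0) (m : ℕ) :
    (z⁻¹ - ((m : ℂ) + 1)).re < -(3 / 4) := by
  have hm : (0 : ℝ) ≤ m := m.cast_nonneg
  have h : (z⁻¹).re ≤ 0 := by
    rw [Complex.inv_re]; exact div_nonpos_of_nonpos_of_nonneg hz.le (Complex.normSq_nonneg z)
  simp only [Complex.sub_re, Complex.add_re, Complex.natCast_re, Complex.one_re]
  linarith

lemma sphere_subset_Dinf {ζ : ℂ} (h : ‖ζ - 1 / 2‖ = 1) : ζ ∈ Dinf := by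
  obtain ⟨h3, h3'⟩ := sqrt_three_bounds
  have hsq : Real.sqrt 3 ^ 2 = 3 := Real.sq_sqrt (by norm_num)
  by_cases him : 1 / 2 < |ζ.im|
  · exact Or.inl (Or.inl him)
  have hn : (ζ.re - 1 / 2) ^ 2 + |ζ.im| ^ 2 = 1 := by
    have : ‖ζ - 1 / 2‖ ^ 2 = 1 := by rw [h]; norm_num
    rw [← Complex.normSq_eq_norm_sq, Complex.normSq_apply] at this
    norm_num at this
    rw [sq_abs]; linarith
  have h4 : (Real.sqrt 3 / 2) ^ 2 ≤ (ζ.re - 1 / 2) ^ 2 := by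
    nlinarith [abs_nonneg ζ.im]
  rw [sq_le_sq, abs_of_nonneg (by positivity), le_abs] at h4
  rcases h4 with h4 | h4
  · refine Or.inr ⟨by linarith, lt_of_lt_of_le ?_ (Complex.re_le_norm _)⟩
    rw [Complex.sub_re, Complex.ofReal_re]
    have : 1 / Real.sqrt 3 = Real.sqrt 3 / 3 := by field_simp; linarith
    rw [this]; linarith
  · refine Or.inl (Or.inr ?_)
    simp only [mem_ofPred_eq]; linarith

lemma isOpen_cutPlane (a b : ℝ) : IsOpen (cutPlane a b) :=
  (isCompact_Icc.image Complex.continuous_ofReal).isClosed.isOpen_compl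

lemma mem_cutPlane_of_one_le {ζ : ℂ} (h : 1 ≤ ‖ζ - 1 / 2‖) : ζ ∈ cutPlane 0 1 := by
  rintro ⟨t, ht, rfl⟩
  have : ((t : ℂ) - 1 / 2) = ((t - 1 / 2 : ℝ) : ℂ) := by push_cast; ring
  rw [this, Complex.norm_real, Real.norm_eq_abs, le_abs] at h
  rcases h with h | h <;> linarith [ht.1, ht.2]

lemma O1.differentiableAt {a b : ℝ} {φ : ℂ → ℂ} (hφ : φ ∈ O1 a b) {z : ℂ} (hz : z ∈ cutPlane a b) :
    DifferentiableAt ℂ φ z :=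
  hφ.1.differentiableAt ((isOpen_cutPlane a b).mem_nhds hz)

lemma O1.circleIntegral_dslope {φ : ℂ → ℂ} (hφ : φ ∈ O1 0 1) {z : ℂ} {R : ℝ} (hR : 1 ≤ R)
    (hzR : ‖z - 1 / 2‖ ≠ R) :
    (∮ ζ in C(1 / 2, R), dslope φ z ζ) = (∮ ζ in C(1 / 2, R), (ζ - z)⁻¹ * φ ζ) -
      (∮ ζ in C(1 / 2, R), (ζ - z)⁻¹) * φ z := by
  have hne : ∀ ζ ∈ Metric.sphere (1 / 2 : ℂ) R, ζ - z ≠ 0 := by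
    intro ζ hζ h
    rw [mem_sphere_iff_norm, sub_eq_zero.mp h] at hζ
    exact hzR hζ
  have hR0 : 0 ≤ R := by linarith
  have hc1 : ContinuousOn (fun ζ => (ζ - z)⁻¹) (Metric.sphere (1 / 2 : ℂ) R) :=
    ContinuousOn.inv₀ (by fun_prop) hne
  have hc2 : ContinuousOn φ (Metric.sphere (1 / 2 : ℂ) R) := fun ζ hζ =>
    (O1.differentiableAt hφ (mem_cutPlane_of_one_le
      (by rw [mem_sphere_iff_norm.mp hζ]; exact hR))).continuousAt.continuousWithinAt
  have e : (∮ ζ in C(1 / 2, R), dslope φ z ζ) =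
      ∮ ζ in C(1 / 2, R), ((ζ - z)⁻¹ * φ ζ - (ζ - z)⁻¹ * φ z) := by
    refine circleIntegral.integral_congr hR0 fun ζ hζ => ?_
    have : ζ ≠ z := sub_ne_zero.mp (hne ζ hζ)
    simp only [dslope_of_ne _ this, slope, vsub_eq_sub, smul_eq_mul]
    ring
  have hi1 : CircleIntegrable (fun ζ => (ζ - z)⁻¹ * φ ζ) (1 / 2) R :=
    (hc1.mul hc2).circleIntegrable hR0
  have hi2 : CircleIntegrable (fun ζ => (ζ - z)⁻¹ * φ z) (1 / 2) R :=
    (hc1.mul continuousOn_const).circleIntegrable hR0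
  rw [e, circleIntegral.integral_sub hi1 hi2]
  congr 1
  simpa [smul_eq_mul] using circleIntegral.integral_smul_const (fun ζ => (ζ - z)⁻¹) (φ z) (1 / 2) R

/-- Cauchy's formula in the exterior of a disc, for functions vanishing at infinity. -/
lemma O1.circleIntegral_exterior {φ : ℂ → ℂ} (hφ : φ ∈ O1 0 1) {z : ℂ} (hz : 1 < ‖z - 1 / 2‖) :
    (∮ ζ in C(1 / 2, 1), (z - ζ)⁻¹ * φ ζ) = 2 * Real.pi * Complex.I * φ z := by
  set d := ‖z - 1 / 2‖ with hd
  have hshift : ∀ R, d < R → (∮ ζ in C(1 / 2, R), (ζ - z)⁻¹ * φ ζ) =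
      (∮ ζ in C(1 / 2, 1), (ζ - z)⁻¹ * φ ζ) + 2 * Real.pi * Complex.I * φ z := by
    intro R hR
    have hann : (∮ ζ in C(1 / 2, R), dslope φ z ζ) = ∮ ζ in C(1 / 2, 1), dslope φ z ζ := by
      have hcut : ∀ ζ ∈ Metric.closedBall (1 / 2 : ℂ) R \ Metric.ball (1 / 2) 1,
          ζ ∈ cutPlane 0 1 := fun ζ hζ =>
        mem_cutPlane_of_one_le (by simpa [dist_eq_norm] using hζ.2)
      refine Complex.circleIntegral_eq_of_differentiable_on_annulus_off_countable one_pos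
        (by linarith) (countable_singleton z) ?_ ?_
      · refine ((continuousOn_dslope ((isOpen_cutPlane 0 1).mem_nhds
          (mem_cutPlane_of_one_le hz.le))).mpr ⟨hφ.1.continuousOn,
          O1.differentiableAt hφ (mem_cutPlane_of_one_le hz.le)⟩).mono hcut
      · intro ζ hζ
        refine (differentiableAt_dslope_of_ne hζ.2).mpr (O1.differentiableAt hφ (hcut ζ ?_))
        exact ⟨Metric.ball_subset_closedBall hζ.1.1,
          fun h => hζ.1.2 (Metric.ball_subset_closedBall h)⟩
    rw [O1.circleIntegral_dslope hφ (by linarith) hR.ne,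
      O1.circleIntegral_dslope hφ le_rfl hz.ne',
      circleIntegral.integral_sub_inv_of_mem_ball (by rwa [mem_ball_iff_norm])] at hann
    have h0 : (∮ ζ in C(1 / 2, 1), (ζ - z)⁻¹) = 0 := by
      have hne : ∀ ζ ∈ Metric.closedBall (1 / 2 : ℂ) 1, ζ - z ≠ 0 := by
        intro ζ hζ h
        rw [mem_closedBall_iff_norm, sub_eq_zero.mp h] at hζ
        linarith
      refine Complex.circleIntegral_eq_zero_of_differentiable_on_off_countable zero_le_one
        countable_empty (ContinuousOn.inv₀ (by fun_prop) hne) fun ζ hζ => ?_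
      exact DifferentiableAt.inv (by fun_prop) (hne ζ (Metric.ball_subset_closedBall hζ.1))
    rw [h0] at hann
    linear_combination hann
  have hzero : (∮ ζ in C(1 / 2, 1), (ζ - z)⁻¹ * φ ζ) + 2 * Real.pi * Complex.I * φ z = 0 := by
    rw [← norm_le_zero_iff]
    refine le_of_forall_pos_le_add fun ε hε => ?_
    rw [zero_add]
    have hev := hφ.2.eventually (Metric.closedBall_mem_nhds (0 : ℂ)
      (show 0 < ε / (4 * Real.pi) by positivity))
    obtain ⟨R₀, -, hR₀⟩ := (hasBasis_cobounded_norm.eventually_iff).mp hev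
    set R := max (|R₀| + 1) (2 * d + 1) with hRdef
    have hR1 : |R₀| + 1 ≤ R := le_max_left _ _
    have hR2 : 2 * d + 1 ≤ R := le_max_right _ _
    have hRpos : 0 < R := by linarith
    rw [← hshift R (by linarith)]
    have hb : ∀ ζ ∈ Metric.sphere (1 / 2 : ℂ) R,
        ‖(ζ - z)⁻¹ * φ ζ‖ ≤ (R / 2)⁻¹ * (ε / (4 * Real.pi)) := by
      intro ζ hζ
      rw [mem_sphere_iff_norm] at hζ
      rw [norm_mul, norm_inv]
      have h1 : R / 2 ≤ ‖ζ - z‖ := by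
        have := norm_sub_norm_le (ζ - 1 / 2) (z - 1 / 2)
        rw [sub_sub_sub_cancel_right, hζ] at this
        linarith
      have h2 : R₀ ≤ ‖ζ‖ := by
        have h := norm_sub_le ζ (1 / 2)
        rw [hζ] at h
        norm_num at h
        linarith [le_abs_self R₀]
      have h3 : ‖φ ζ‖ ≤ ε / (4 * Real.pi) := by simpa using hR₀ h2
      gcongr
    refine (circleIntegral.norm_integral_le_of_norm_le_const hRpos.le hb).trans (le_of_eq ?_)
    field_simp
    norm_num
  have e : (∮ ζ in C(1 / 2, 1), (z - ζ)⁻¹ * φ ζ) =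
      -∮ ζ in C(1 / 2, 1), (ζ - z)⁻¹ * φ ζ := by
    rw [← neg_one_smul ℂ (∮ ζ in C(1 / 2, 1), (ζ - z)⁻¹ * φ ζ), ← circleIntegral.integral_smul]
    congr 1
    ext ζ
    rw [← neg_sub, inv_neg, smul_eq_mul]; ring
  rw [e]
  linear_combination -hzero

lemma one_lt_norm_sub_half {z : ℂ} (hz : z ∉ truncDisc) : 1 < ‖z - 1 / 2‖ := by
  by_contra! h
  refine hz ⟨?_, ?_⟩
  · have := norm_sub_norm_le z (1 / 2)
    norm_num at this h
    linarith
  · have := (abs_le.mp ((Complex.abs_re_le_norm _).trans h)).1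
    norm_num at this
    linarith

lemma circleMap_mem_truncDisc (θ : ℝ) : circleMap (1 / 2) 1 θ ∈ truncDisc := by
  by_contra hz
  exact (one_lt_norm_sub_half hz).ne' (by simp [circleMap])

lemma O1.exists_isCauchyTransform {φ : ℂ → ℂ} (hφ : φ ∈ O1 0 1) {M : ℝ} (hM : 0 ≤ M)
    (hb : ∀ ζ, ‖ζ - 1 / 2‖ = 1 → ‖φ ζ‖ ≤ M) :
    ∃ ℓ : C(truncDisc, ℂ) →L[ℂ] ℂ, ‖ℓ‖ ≤ M ∧ IsCauchyTransform φ ℓ := by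
  have hnorm : ∀ θ : ℝ, ‖circleMap (1 / 2) 1 θ - 1 / 2‖ = 1 := fun θ => by simp [circleMap]
  let γ : ℝ → truncDisc := fun θ => ⟨circleMap (1 / 2) 1 θ, circleMap_mem_truncDisc θ⟩
  have hγ : Continuous γ := (continuous_circleMap _ _).subtype_mk _
  have hφc : Continuous fun θ => φ (circleMap (1 / 2) 1 θ) :=
    continuous_iff_continuousAt.mpr fun θ =>
      ContinuousAt.comp (f := circleMap (1 / 2) 1) (O1.differentiableAt hφ
        (mem_cutPlane_of_one_le (hnorm θ).ge)).continuousAt (continuous_circleMap _ _).continuousAt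
  have hdc : Continuous fun θ => deriv (circleMap (1 / 2) 1) θ := by
    simp_rw [deriv_circleMap]; fun_prop
  have hint : ∀ f : C(truncDisc, ℂ), Continuous fun θ =>
      deriv (circleMap (1 / 2) 1) θ * (f (γ θ) * φ (circleMap (1 / 2) 1 θ)) := fun f =>
    hdc.mul ((f.continuous.comp hγ).mul hφc)
  let ℓ₀ : C(truncDisc, ℂ) →ₗ[ℂ] ℂ :=
    { toFun := fun f => (2 * Real.pi * Complex.I)⁻¹ * ∫ θ in (0)..(2 * Real.pi),
        deriv (circleMap (1 / 2) 1) θ * (f (γ θ) * φ (circleMap (1 / 2) 1 θ))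
      map_add' := fun f g => by
        rw [← mul_add, ← intervalIntegral.integral_add ((hint f).intervalIntegrable _ _)
          ((hint g).intervalIntegrable _ _)]
        congr 1
        refine intervalIntegral.integral_congr fun θ _ => ?_
        simp only [ContinuousMap.add_apply]; ring
      map_smul' := fun a f => by
        rw [RingHom.id_apply, smul_eq_mul, mul_left_comm, ← intervalIntegral.integral_const_mul a]
        congr 1
        refine intervalIntegral.integral_congr fun θ _ => ?_
        simp only [ContinuousMap.smul_apply, smul_eq_mul]; ring }
  have hℓ₀ : ∀ f, ‖ℓ₀ f‖ ≤ M * ‖f‖ := by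
    intro f
    have hI : ‖∫ θ in (0)..(2 * Real.pi),
        deriv (circleMap (1 / 2) 1) θ * (f (γ θ) * φ (circleMap (1 / 2) 1 θ))‖ ≤
        (‖f‖ * M) * |2 * Real.pi - 0| := by
      refine intervalIntegral.norm_integral_le_of_norm_le_const fun θ _ => ?_
      have h1 : ‖deriv (circleMap (1 / 2) 1) θ‖ = 1 := by simp [deriv_circleMap]
      rw [norm_mul, norm_mul, h1, one_mul]
      exact mul_le_mul (f.norm_coe_le_norm _) (hb _ (hnorm θ)) (norm_nonneg _) (norm_nonneg _)
    have hpi : ‖(2 * Real.pi * Complex.I : ℂ)⁻¹‖ = (2 * Real.pi)⁻¹ := by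
      simp [abs_of_pos Real.pi_pos]
    rw [sub_zero, abs_of_pos Real.two_pi_pos] at hI
    change ‖(2 * Real.pi * Complex.I : ℂ)⁻¹ * _‖ ≤ _
    rw [norm_mul, hpi]
    calc _ ≤ (2 * Real.pi)⁻¹ * (‖f‖ * M * (2 * Real.pi)) := by gcongr
      _ = M * ‖f‖ := by field_simp
  refine ⟨ℓ₀.mkContinuous M hℓ₀, ℓ₀.mkContinuous_norm_le hM _, fun z hz => ?_⟩
  have hC := O1.circleIntegral_exterior hφ (one_lt_norm_sub_half hz)
  change _ = (2 * Real.pi * Complex.I : ℂ)⁻¹ * ∫ θ in (0)..(2 * Real.pi),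
        deriv (circleMap (1 / 2) 1) θ * (cauchyKernel z (γ θ) * φ (circleMap (1 / 2) 1 θ))
  simp_rw [cauchyKernel_apply hz]
  rw [eq_inv_mul_iff_mul_eq₀ Complex.two_pi_I_ne_zero, ← hC]
  rfl

lemma IsCauchyTransform.norm_iterate_three_le {φ : ℂ → ℂ} {ℓ : C(truncDisc, ℂ) →L[ℂ] ℂ}
    (h : IsCauchyTransform φ ℓ) {L : ℝ} (hL : ∀ r : ℕ, ‖ℓ.comp (transfer ^ r)‖ ≤ L) {z : ℂ}
    (hz : z ∈ Dinf) :
    ‖(Tbrj^[3] φ) z‖ ≤ stepConst * (stepConst * (stepConst * (4 * L + L) + L) + L) := by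
  have hC := stepConst_nonneg
  have h0 : ∀ w : ℂ, w.re < -(3 / 4) → ‖φ w‖ ≤ 4 * L := fun w hw =>
    (h.norm_le_of_far (Or.inr hw)).trans (mul_le_mul_of_nonneg_left (hL 0) (by norm_num))
  have h1 : ∀ w : ℂ, w.re < -(1 / 10) → ‖(Tbrj^[1] φ) w‖ ≤ stepConst * (4 * L + L) := by
    intro w hw
    have hn : 1 / 10 ≤ ‖w‖ := by linarith [Complex.abs_re_le_norm w, neg_abs_le w.re]
    refine (h.norm_Tbrj_le hn fun m => h0 _ (inv_sub_re_lt_of_re_neg (by linarith) m)).trans ?_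
    gcongr; exact hL 0
  have h2 : ∀ w : ℂ, (w.re < -(1 / 10) ∨ 5 / 9 < |w.im|) →
      ‖(Tbrj^[2] φ) w‖ ≤ stepConst * (stepConst * (4 * L + L) + L) := by
    intro w hw
    have hn : 1 / 10 ≤ ‖w‖ := by
      rcases hw with hw | hw
      · linarith [Complex.abs_re_le_norm w, neg_abs_le w.re]
      · linarith [Complex.abs_im_le_norm w]
    rw [Function.iterate_succ_apply']
    refine ((h.iterate_Tbrj 1).norm_Tbrj_le hn
      fun m => h1 _ (inv_sub_re_lt_of_near hw m)).trans ?_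
    gcongr; exact hL 1
  rw [Function.iterate_succ_apply']
  refine ((h.iterate_Tbrj 2).norm_Tbrj_le (norm_ge_of_mem_Dinf hz)
    fun m => h2 _ (inv_sub_near_of_mem_Dinf hz m)).trans ?_
  gcongr; exact hL 2

lemma IsCauchyTransform.norm_iterate_le {φ : ℂ → ℂ} {ℓ : C(truncDisc, ℂ) →L[ℂ] ℂ}
    (h : IsCauchyTransform φ ℓ) {L : ℝ} (hL : ∀ r : ℕ, ‖ℓ.comp (transfer ^ r)‖ ≤ L)
    (hφ : ∀ z ∈ Dinf, ‖φ z‖ ≤ L) (r : ℕ) {z : ℂ} (hz : z ∈ Dinf) :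
    ‖(Tbrj^[r] φ) z‖ ≤ (2 * stepConst + 1) ^ r * L := by
  have hC := stepConst_nonneg
  have hL0 : 0 ≤ L := (norm_nonneg _).trans (hL 0)
  induction r generalizing z with
  | zero => simpa using hφ z hz
  | succ r ih =>
    rw [Function.iterate_succ_apply']
    refine ((h.iterate_Tbrj r).norm_Tbrj_le (norm_ge_of_mem_Dinf hz)
      fun m => ih (inv_sub_mem_Dinf hz m)).trans ?_
    have h1 : L ≤ (2 * stepConst + 1) ^ r * L :=
      le_mul_of_one_le_left hL0 (one_le_pow₀ (by linarith))
    calc _ ≤ stepConst * ((2 * stepConst + 1) ^ r * L + (2 * stepConst + 1) ^ r * L) := by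
          gcongr; exact (hL r).trans h1
      _ = 2 * stepConst * ((2 * stepConst + 1) ^ r * L) := by ring
      _ ≤ (2 * stepConst + 1) * ((2 * stepConst + 1) ^ r * L) := by gcongr; linarith
      _ = _ := by ring

lemma norm_comp_transfer_pow_le {ℓ : C(truncDisc, ℂ) →L[ℂ] ℂ} {M : ℝ} (hℓ : ‖ℓ‖ ≤ M) (r : ℕ) :
    ‖ℓ.comp (transfer ^ r)‖ ≤ 48 * Real.goldenRatio⁻¹ ^ r * M :=
  calc ‖ℓ.comp (transfer ^ r)‖ ≤ ‖ℓ‖ * ‖transfer ^ r‖ := ℓ.opNorm_comp_le _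
    _ ≤ M * (48 * Real.goldenRatio⁻¹ ^ r) :=
      mul_le_mul hℓ (norm_transfer_pow_le r) (norm_nonneg _) ((norm_nonneg _).trans hℓ)
    _ = _ := by ring

end

/-- the iterates of `T` contract on `D∞` with rate `(√5 − 1)/2`. -/
theorem T_spectral_estimate_on_Dinf :
    ∃ c > 0, ∀ (r : ℕ), ∀ φ ∈ O1 0 1, ∀ M : ℝ,
      (∀ z ∈ Dinf, ‖φ z‖ ≤ M) →
        ∀ z ∈ Dinf, ‖(Tbrj^[r] φ) z‖ ≤ c * ((Real.sqrt 5 - 1) / 2) ^ r * M := by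
  have hlam : (Real.sqrt 5 - 1) / 2 = Real.goldenRatio⁻¹ := by
    rw [Real.inv_goldenRatio, Real.goldenConj]; ring
  rw [hlam]
  set lam := Real.goldenRatio⁻¹ with hlamdef
  have hl0 : 0 < lam := inv_pos.mpr Real.goldenRatio_pos
  have hl1 : lam ≤ 1 := inv_le_one_of_one_le₀ Real.one_lt_goldenRatio.le
  have hC := stepConst_nonneg
  set C := stepConst
  set K := (2 * C + 1) ^ 3
  have hK1 : 1 ≤ 2 * C + 1 := by linarith
  refine ⟨240 * K * (lam ^ 3)⁻¹, by positivity, fun r φ hφ M hM z hz => ?_⟩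
  have hM0 : 0 ≤ M := (norm_nonneg _).trans (hM z hz)
  obtain ⟨ℓ, hℓ, hrep⟩ := O1.exists_isCauchyTransform hφ hM0
    fun ζ hζ => hM ζ (sphere_subset_Dinf hζ)
  rcases lt_or_ge r 3 with hr | hr
  · have hL : ∀ s : ℕ, ‖ℓ.comp (transfer ^ s)‖ ≤ 48 * M := fun s =>
      (norm_comp_transfer_pow_le hℓ s).trans <| by
        have : lam ^ s ≤ 1 := pow_le_one₀ hl0.le hl1
        nlinarith
    have h1 := hrep.norm_iterate_le hL (fun w hw => (hM w hw).trans (by linarith)) r hz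
    have h2 : (2 * C + 1) ^ r ≤ K := pow_le_pow_right₀ hK1 hr.le
    have h3 : lam ^ 3 ≤ lam ^ r := pow_le_pow_of_le_one hl0.le hl1 hr.le
    have h4 : 1 ≤ (lam ^ 3)⁻¹ * lam ^ r := by
      rw [← div_eq_inv_mul, one_le_div (by positivity)]; exact h3
    calc _ ≤ (2 * C + 1) ^ r * (48 * M) := h1
      _ ≤ K * (240 * M) := by gcongr; norm_num
      _ = 240 * K * M * 1 := by ring
      _ ≤ 240 * K * M * ((lam ^ 3)⁻¹ * lam ^ r) := by gcongr
      _ = _ := by ring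
  · obtain ⟨s, rfl⟩ := Nat.exists_eq_add_of_le hr
    have hL : ∀ t : ℕ, ‖(ℓ.comp (transfer ^ s)).comp (transfer ^ t)‖ ≤ 48 * lam ^ s * M := by
      intro t
      have e : (ℓ.comp (transfer ^ s)).comp (transfer ^ t) = ℓ.comp (transfer ^ (s + t)) := by
        rw [pow_add]; rfl
      rw [e]
      refine (norm_comp_transfer_pow_le hℓ _).trans ?_
      have : lam ^ (s + t) ≤ lam ^ s := pow_le_pow_of_le_one hl0.le hl1 (Nat.le_add_right _ _)
      gcongr
    have h1 := (hrep.iterate_Tbrj s).norm_iterate_three_le hL hz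
    rw [← Function.iterate_add_apply] at h1
    refine h1.trans ?_
    set L := 48 * lam ^ s * M
    have hL0 : 0 ≤ L := by positivity
    have e : 240 * K * (lam ^ 3)⁻¹ * lam ^ (3 + s) * M = 5 * K * L := by
      simp only [L]; rw [pow_add]; field_simp; ring
    rw [e]
    have hpoly : C * (C * (C * 5 + 1) + 1) ≤ 5 * K := by
      simp only [K]
      nlinarith [pow_nonneg hC 2, pow_nonneg hC 3]
    calc _ = C * (C * (C * 5 + 1) + 1) * L := by ring
      _ ≤ 5 * K * L := by gcongr
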